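/- arXiv:1705.09834 — 2 statements merged into one kernel-verified Lean document; each statement's English description precedes it below -/
import Mathlib

section
/- Let L be a Banach space and C ⊆ B_L a nonempty, closed, convex, balanced subset of the closed unit ball, with Minkowski functional 𝔣(x) = inf{λ > 0 : x ∈ λC}. Then span(C), equipped with the norm 𝔣, is a Banach space. -/
namespace PaperAUS

open Pointwise Filter Topology

theorem aux_span {L : Type*} [NormedAddCommGroup L] [NormedSpace ℝ L]
    (C : Set L) (hne : C.Nonempty) (hconv : Convex ℝ C) (hbal : Balanced ℝ C)
    (x : L) (hx : x ∈ Submodule.span ℝ C) : ∃ r : ℝ, 0 < r ∧ x ∈ r • C := by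
  have h0 : (0 : L) ∈ C := hbal.zero_mem hne
  induction hx using Submodule.span_induction with
  | mem x h => exact ⟨1, one_pos, by simpa using h⟩
  | zero => exact ⟨1, one_pos, by simpa using h0⟩
  | add x y _ _ ihx ihy =>
    obtain ⟨r, hr, hx⟩ := ihx
    obtain ⟨t, ht, hy⟩ := ihy
    refine ⟨r + t, by positivity, ?_⟩
    rw [hconv.add_smul hr.le ht.le]
    exact Set.add_mem_add hx hy
  | smul a x _ ih =>
    obtain ⟨r, hr, hx⟩ := ih
    refine ⟨(|a| + 1) * r, by positivity, ?_⟩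
    obtain ⟨c, hc, rfl⟩ := hx
    have hs : a • C ⊆ (|a| + 1) • C := hbal.smul_mono (by
      rw [Real.norm_eq_abs, Real.norm_eq_abs, abs_of_pos (by positivity : 0 < |a| + 1)]; linarith)
    obtain ⟨d, hd, h⟩ := hs (Set.smul_mem_smul_set hc)
    refine ⟨d, hd, ?_⟩
    simp only at h ⊢
    rw [mul_comm, mul_smul, h, smul_comm]

theorem aux_mem {L : Type*} [NormedAddCommGroup L] [NormedSpace ℝ L]
    (C : Set L) (hne : C.Nonempty) (hconv : Convex ℝ C) (hbal : Balanced ℝ C)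
    (x : L) (hx : x ∈ Submodule.span ℝ C) (a : ℝ) (h : gauge C x < a) : x ∈ a • C := by
  obtain ⟨r0, hr0, hx0⟩ := aux_span C hne hconv hbal x hx
  obtain ⟨r, ⟨hr, hxr⟩, hra⟩ := exists_lt_of_csInf_lt
    (s := {r : ℝ | r ∈ Set.Ioi (0 : ℝ) ∧ x ∈ r • C}) ⟨r0, hr0, hx0⟩ h
  have hr : 0 < r := hr
  refine hbal.smul_mono ?_ hxr
  rw [Real.norm_eq_abs, Real.norm_eq_abs, abs_of_pos hr, abs_of_pos (hr.trans hra)]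
  exact hra.le

theorem aux_norm {L : Type*} [NormedAddCommGroup L] [NormedSpace ℝ L]
    (C : Set L) (hC : C ⊆ Metric.closedBall 0 1) (x : L) (a : ℝ) (ha : 0 ≤ a)
    (h : x ∈ a • C) : ‖x‖ ≤ a := by
  obtain ⟨c, hc, rfl⟩ := h
  have := hC hc
  rw [mem_closedBall_zero_iff] at this
  simp only [norm_smul, Real.norm_eq_abs, abs_of_nonneg ha]
  nlinarith


/-- If `C` is a nonempty, closed, convex, balanced subset of the closed unit ball of a Banach
space `L`, then the span of `C`, equipped with the Minkowski functional (gauge) of `C` as a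
norm, is a Banach space: the gauge is a genuine norm on `span C`, and `span C` is complete
with respect to it. -/
theorem span_gauge_banach {L : Type*} [NormedAddCommGroup L] [NormedSpace ℝ L]
    [CompleteSpace L] (C : Set L) (hC : C ⊆ Metric.closedBall 0 1) (hne : C.Nonempty)
    (hcl : IsClosed C) (hconv : Convex ℝ C) (hbal : Balanced ℝ C) :
    (∀ x ∈ Submodule.span ℝ C, 0 ≤ gauge C x) ∧
    (∀ x ∈ Submodule.span ℝ C, (gauge C x = 0 ↔ x = 0)) ∧
    (∀ x ∈ Submodule.span ℝ C, ∀ y ∈ Submodule.span ℝ C,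
      gauge C (x + y) ≤ gauge C x + gauge C y) ∧
    (∀ (c : ℝ), ∀ x ∈ Submodule.span ℝ C, gauge C (c • x) = |c| * gauge C x) ∧
    (∀ u : ℕ → L, (∀ n, u n ∈ Submodule.span ℝ C) →
      (∀ ε : ℝ, 0 < ε → ∃ N, ∀ m ≥ N, ∀ n ≥ N, gauge C (u m - u n) < ε) →
      ∃ x ∈ Submodule.span ℝ C, ∀ ε : ℝ, 0 < ε → ∃ N, ∀ n ≥ N, gauge C (u n - x) < ε) := by
  have hmem := aux_mem C hne hconv hbal
  have hnorm := aux_norm C hC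
  refine ⟨fun x _ => gauge_nonneg x, fun x hx => ⟨fun h => ?_, fun h => by simp [h]⟩,
    fun x hx y hy => ?_, fun c x _ => ?_, fun u hu hcau => ?_⟩
  · rw [← norm_le_zero_iff]
    refine le_of_forall_pos_le_add fun ε hε => ?_
    rw [zero_add]
    exact hnorm x ε hε.le (hmem x hx ε (by rwa [h]))
  · refine le_of_forall_pos_le_add fun ε hε => ?_
    have h1 := hmem x hx (gauge C x + ε / 2) (by linarith)
    have h2 := hmem y hy (gauge C y + ε / 2) (by linarith)
    have p1 := gauge_nonneg (s := C) x
    have p2 := gauge_nonneg (s := C) y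
    have h3 := Set.add_mem_add h1 h2
    rw [← hconv.add_smul (by linarith) (by linarith)] at h3
    have := gauge_le_of_mem (by linarith) h3
    linarith
  · rw [gauge_smul hbal, Real.norm_eq_abs]
  · have hc : CauchySeq u := by
      rw [Metric.cauchySeq_iff]
      intro ε hε
      obtain ⟨N, hN⟩ := hcau (ε / 2) (by linarith)
      refine ⟨N, fun m hm n hn => ?_⟩
      rw [dist_eq_norm]
      have := hnorm _ (ε / 2) (by linarith)
        (hmem _ (Submodule.sub_mem _ (hu m) (hu n)) _ (hN m hm n hn))
      linarith
    obtain ⟨x, hx⟩ := cauchySeq_tendsto_of_complete hc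
    have key : ∀ ε : ℝ, 0 < ε → ∃ N, ∀ n ≥ N, u n - x ∈ ε • C := by
      intro ε hε
      obtain ⟨N, hN⟩ := hcau ε hε
      refine ⟨N, fun n hn => ?_⟩
      have hcl' : IsClosed (ε • C) := hcl.smul₀ ε
      refine hcl'.mem_of_tendsto (tendsto_const_nhds.sub hx) ?_
      filter_upwards [eventually_ge_atTop N] with m hm
      exact hmem _ (Submodule.sub_mem _ (hu n) (hu m)) _ (hN n hn m hm)
    refine ⟨x, ?_, fun ε hε => ?_⟩
    · obtain ⟨N, hN⟩ := key 1 one_pos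
      have h := hN N le_rfl
      rw [one_smul] at h
      have := Submodule.sub_mem _ (hu N) (Submodule.subset_span h)
      simpa using this
    · obtain ⟨N, hN⟩ := key (ε / 2) (by linarith)
      refine ⟨N, fun n hn => ?_⟩
      have := gauge_le_of_mem (by linarith) (hN n hn)
      linarith

end PaperAUS
end

section
/- Let X, Y be Banach spaces, ξ an ordinal, A, B : X → Y bounded operators, and α, β > 0 with α + β = 1. Then for every σ > 0, the ξ-asymptotic smoothness modulus satisfies ϱ_ξ(σ, αA + βB) ≤ α·ϱ_ξ(σ, A) + β·ϱ_ξ(σ, B); that is, ϱ_ξ(σ, ·) is a convex function of the operator. -/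
open Ordinal Filter

namespace PaperAUS

/-- A tree on `Λ`: a set of nonempty finite sequences closed under nonempty initial segments. -/
def IsTree {Λ : Type*} (T : Set (List Λ)) : Prop :=
  [] ∉ T ∧ ∀ s t : List Λ, t ∈ T → s <+: t → s ≠ [] → s ∈ T

/-- The maximal nodes of `T`: those with no proper extension in `T`. -/
def maxNodes {Λ : Type*} (T : Set (List Λ)) : Set (List Λ) :=
  {t ∈ T | ∀ s ∈ T, t <+: s → s = t}

/-- Transfinite derivatives of a tree, removing maximal nodes at each step. -/
noncomputable def derivIter {Λ : Type*} (T : Set (List Λ)) (ξ : Ordinal) : Set (List Λ) :=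
  Ordinal.limitRecOn ξ T (fun _ ih => ih \ maxNodes ih)
    (fun o _ ih => ⋂ ζ : Set.Iio o, ih ζ ζ.2)

/-- The rank `o(T)` of a (well-founded) tree: least `ξ` with `T^ξ = ∅`. -/
noncomputable def treeRank {Λ : Type*} (T : Set (List Λ)) : Ordinal :=
  sInf {ξ | derivIter T ξ = ∅}

/-- `T.D`: the tree of sequences of pairs whose first coordinates form a member of `T`. -/
def TD {Λ : Type*} (T : Set (List Λ)) (D : Type*) : Set (List (Λ × D)) :=
  {l | l.map Prod.fst ∈ T}

/-- `r` is (the order of) a directed set. -/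
def IsDirSys {D : Type*} (r : D → D → Prop) : Prop :=
  (∀ a, r a a) ∧ (∀ a b c, r a b → r b c → r a c) ∧ ∀ a b, ∃ c, r a c ∧ r b c

/-- The filter of eventual sections of a directed order, used to express convergence of nets. -/
def netFilter {D : Type*} (r : D → D → Prop) : Filter D :=
  ⨅ a, Filter.principal {b | r a b}

/-- A collection `(x_t)_{t ∈ T.D}` is weakly null: along every family of immediate successor
nodes, the corresponding net is weakly null. -/
def WeaklyNullColl {Λ D : Type*} {X : Type*} [NormedAddCommGroup X] [NormedSpace ℝ X]
    (T : Set (List Λ)) (r : D → D → Prop) (x : List (Λ × D) → X) : Prop :=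
  ∀ (t : List (Λ × D)) (ζ : Λ), (∀ u : D, t ++ [(ζ, u)] ∈ TD T D) →
    ∀ f : X →L[ℝ] ℝ, Tendsto (fun u : D => f (x (t ++ [(ζ, u)]))) (netFilter r) (nhds 0)

/-- The set `{x_s : ∅ < s ≤ t}` of members of the collection along the branch below `t`. -/
def branchSet {Λ D : Type*} {X : Type*} (x : List (Λ × D) → X) (t : List (Λ × D)) : Set X :=
  {v | ∃ s, s ≠ [] ∧ s <+: t ∧ v = x s}

/-- The `ξ`-asymptotic smoothness modulus `ϱ_ξ(σ, A)` of an operator. -/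
noncomputable def rho {X Y : Type*} [NormedAddCommGroup X] [NormedSpace ℝ X]
    [NormedAddCommGroup Y] [NormedSpace ℝ Y] (ξ : Ordinal) (A : X →L[ℝ] Y) (σ : ℝ) : ℝ :=
  sSup {ρ : ℝ | ∃ (Λ D : Type) (r : D → D → Prop) (T : Set (List Λ))
    (y : Y) (x : List (Λ × D) → X),
    Nonempty D ∧ IsDirSys r ∧ IsTree T ∧ treeRank T = omega0 ^ ξ ∧
    ‖y‖ ≤ 1 ∧ (∀ t ∈ TD T D, ‖x t‖ ≤ σ) ∧ WeaklyNullColl T r x ∧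
    ρ = sInf {c : ℝ | ∃ t ∈ TD T D, ∃ v ∈ convexHull ℝ (branchSet x t), c = ‖y + A v‖ - 1}}

end PaperAUS

namespace PaperAUS

universe w

theorem exists_natSum (ι : Type) [Finite ι] :
    ∃ S : (ι → Ordinal.{w}) → Ordinal.{w}, StrictMono S ∧
      ∀ (ξ : Ordinal.{w}) (f : ι → Ordinal.{w}), (∀ k, f k < omega0 ^ ξ) → S f < omega0 ^ ξ := by
  classical
  have := Fintype.ofFinite ι
  have wf : WellFounded (fun f g : ι → Ordinal.{w} => f < g) := wellFounded_lt
  let S : (ι → Ordinal.{w}) → Ordinal.{w} :=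
    wf.fix (fun f ih => sInf {c | ∀ g, ∀ h : g < f, ih g h < c})
  have hS : ∀ f, S f = sInf {c | ∀ g, g < f → S g < c} := fun f => by
    rw [show S f = _ from wf.fix_eq _ f]
  have hne : ∀ f, {c | ∀ g, g < f → S g < c}.Nonempty := by
    intro f
    have hs : Small.{w} (Set.Iic f) := by
      let φ : Set.Iic f → (∀ k, Set.Iic (f k)) := fun g k => ⟨g.1 k, g.2 k⟩
      refine small_of_injective (f := φ) ?_
      intro a b hab
      ext k
      exact congrArg Subtype.val (congrFun hab k)
    have hb : BddAbove (S '' Set.Iic f) := by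
      have : Small.{w} (S '' Set.Iic f) := inferInstance
      exact Ordinal.bddAbove_of_small
    obtain ⟨c, hc⟩ := hb
    refine ⟨c + 1, fun g hg => ?_⟩
    exact lt_of_le_of_lt (hc ⟨g, hg.le, rfl⟩) (lt_add_one c)
  have hlt : ∀ f g, g < f → S g < S f := fun f => by
    have := csInf_mem (hne f)
    rw [← hS] at this
    exact this
  have hle : ∀ f c, (∀ g, g < f → S g < c) → S f ≤ c := fun f c h => by
    rw [hS]; exact csInf_le' h
  refine ⟨S, fun g f h => hlt f g h, ?_⟩
  intro ξ
  induction ξ using Ordinal.limitRecOn with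
  | zero =>
    intro f hf
    rw [opow_zero] at *
    rw [Order.lt_one_iff, ← nonpos_iff_eq_zero]
    apply hle
    intro g hg
    obtain ⟨_, k, hk⟩ := Pi.lt_def.1 hg
    have := hf k
    rw [Order.lt_one_iff] at this
    rw [this] at hk
    exact absurd hk not_lt_zero
  | add_one ζ ih =>
    have hp : (omega0 : Ordinal.{w}) ^ ζ ≠ 0 := (opow_pos ζ omega0_pos).ne'
    have key : ∀ f : ι → Ordinal.{w}, ∀ n : ι → ℕ, ∀ c : ι → Ordinal.{w},
        (∀ k, c k < omega0 ^ ζ) → (∀ k, f k = omega0 ^ ζ * (n k : Ordinal.{w}) + c k) →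
        S f ≤ omega0 ^ ζ * ((∑ k, n k : ℕ) : Ordinal.{w}) + S c := by
      intro f
      induction f using wf.induction with
      | _ f IH =>
      intro n c hc hf
      apply hle
      intro g hg
      obtain ⟨hgle, k0, hk0⟩ := Pi.lt_def.1 hg
      have hdiv : ∀ k, ∃ m : ℕ, g k / omega0 ^ ζ = (m : Ordinal.{w}) ∧ m ≤ n k := by
        intro k
        have h1 : g k / omega0 ^ ζ ≤ (n k : Ordinal.{w}) := by
          rw [← Order.lt_add_one_iff, ← Ordinal.lt_mul_iff_div_lt hp]
          refine lt_of_le_of_lt (hgle k) ?_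
          rw [hf k, mul_add, mul_one]
          exact (add_lt_add_iff_left _).2 (hc k)
        obtain ⟨m, hm⟩ := lt_omega0.1 (h1.trans_lt (natCast_lt_omega0 _))
        exact ⟨m, hm, by rw [hm] at h1; exact_mod_cast h1⟩
      choose m hm hmn using hdiv
      have hg' : ∀ k, g k = omega0 ^ ζ * (m k : Ordinal.{w}) + g k % omega0 ^ ζ := fun k => by
        rw [← hm k, Ordinal.div_add_mod]
      have hmod : ∀ k, g k % omega0 ^ ζ < omega0 ^ ζ := fun k => Ordinal.mod_lt _ hp
      have h2 := IH g hg m (fun k => g k % omega0 ^ ζ) hmod hg'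
      refine lt_of_le_of_lt h2 ?_
      by_cases hmeq : m = n
      · subst hmeq
        refine (add_lt_add_iff_left _).2 (hlt _ _ ?_)
        rw [Pi.lt_def]
        constructor
        · intro k
          have := hgle k
          rw [hg' k, hf k] at this
          exact (add_le_add_iff_left _).1 this
        · refine ⟨k0, ?_⟩
          rw [hg' k0, hf k0] at hk0
          exact (add_lt_add_iff_left _).1 hk0
      · have hlt' : ∑ k, m k < ∑ k, n k := by
          obtain ⟨k, hk⟩ := Function.ne_iff.1 hmeq
          exact Finset.sum_lt_sum (fun k _ => hmn k) ⟨k, Finset.mem_univ _, lt_of_le_of_ne (hmn k) hk⟩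
        calc _ < omega0 ^ ζ * ((∑ k, m k : ℕ) : Ordinal.{w}) + omega0 ^ ζ :=
              (add_lt_add_iff_left _).2 (ih _ hmod)
          _ = omega0 ^ ζ * ((∑ k, m k + 1 : ℕ) : Ordinal.{w}) := by
              rw [Nat.cast_add, mul_add, Nat.cast_one, mul_one]
          _ ≤ omega0 ^ ζ * ((∑ k, n k : ℕ) : Ordinal.{w}) := by
              gcongr; exact hlt'
          _ ≤ _ := le_self_add
    intro f hf
    have hdiv : ∀ k, ∃ m : ℕ, f k / omega0 ^ ζ = (m : Ordinal.{w}) := by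
      intro k
      apply lt_omega0.1
      rw [← Ordinal.lt_mul_iff_div_lt hp, ← opow_add_one]
      exact hf k
    choose m hm using hdiv
    have h1 := key f m (fun k => f k % omega0 ^ ζ) (fun k => Ordinal.mod_lt _ hp)
      (fun k => by rw [← hm k, Ordinal.div_add_mod])
    have h2 := ih (fun k => f k % omega0 ^ ζ) (fun k => Ordinal.mod_lt _ hp)
    calc S f < omega0 ^ ζ * ((∑ k, m k : ℕ) : Ordinal.{w}) + omega0 ^ ζ :=
              lt_of_le_of_lt h1 ((add_lt_add_iff_left _).2 h2)
      _ = omega0 ^ ζ * ((∑ k, m k + 1 : ℕ) : Ordinal.{w}) := by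
              rw [Nat.cast_add, mul_add, Nat.cast_one, mul_one]
      _ < omega0 ^ ζ * omega0 := by
              gcongr
              exact natCast_lt_omega0 _
      _ = _ := (opow_add_one _ _).symm
  | limit o ho ih =>
    intro f hf
    have h1 : ∀ k, ∃ ζ < o, f k < omega0 ^ ζ := fun k =>
      (lt_opow_of_isSuccLimit omega0_ne_zero ho).1 (hf k)
    choose ζ hζ hfζ using h1
    by_cases hι : Nonempty ι
    · obtain ⟨k, hk⟩ := Finite.exists_max ζ
      refine (ih (ζ k) (hζ k) f fun j => (hfζ j).trans_le
        (opow_le_opow_right omega0_pos (hk j))).trans_le (opow_le_opow_right omega0_pos (hζ k).le)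
    · refine lt_of_le_of_lt (hle f 0 ?_) (opow_pos o omega0_pos)
      intro g hg
      obtain ⟨_, k, _⟩ := Pi.lt_def.1 hg
      exact absurd ⟨k⟩ hι

/-- Iterated derivative along a filter. -/
def Dv {N : Type} (F : Filter N) (G : List N → Prop) (γ : Ordinal.{w}) (s : List N) : Prop :=
  G s ∧ ∀ γ', (h : γ' < γ) → ∃ᶠ n in F, Dv F G γ' (s ++ [n])
termination_by γ
decreasing_by exact h

theorem Dv_iff {N : Type} (F : Filter N) (G : List N → Prop) (γ : Ordinal.{w}) (s : List N) :
    Dv F G γ s ↔ G s ∧ ∀ γ' < γ, ∃ᶠ n in F, Dv F G γ' (s ++ [n]) := by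
  rw [Dv]

theorem Dv_anti {N : Type} {F : Filter N} {G : List N → Prop} {γ δ : Ordinal.{w}} {s : List N}
    (h : Dv F G γ s) (hd : δ ≤ γ) : Dv F G δ s := by
  rw [Dv_iff] at *
  exact ⟨h.1, fun γ' h' => h.2 γ' (h'.trans_le hd)⟩

theorem exists_rank {N : Type} (F : Filter N) (G : List N → Prop) (Ω : Ordinal.{w}) :
    ∃ R : List N → Ordinal.{w}, (∀ u, R u ≤ Ω) ∧ (∀ u, G u → Dv F G (R u) u) ∧
      ∀ u, G u → R u < Ω → ∀ᶠ n in F, G (u ++ [n]) → R (u ++ [n]) < R u := by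
  let R : List N → Ordinal.{w} := fun u => sInf {γ | Ω ≤ γ ∨ ¬ Dv F G (γ + 1) u}
  have h2 : ∀ u, G u → Dv F G (R u) u := by
    intro u hu
    rw [Dv_iff]
    refine ⟨hu, fun γ' h' => ?_⟩
    have := notMem_of_lt_csInf h' (OrderBot.bddBelow _)
    simp only [Set.mem_ofPred_eq, not_or, not_not] at this
    exact ((Dv_iff _ _ _ _).1 this.2).2 γ' (lt_add_one γ')
  refine ⟨R, fun u => csInf_le' (Or.inl le_rfl), h2, ?_⟩
  intro u hu hR
  have hm : R u ∈ {γ | Ω ≤ γ ∨ ¬ Dv F G (γ + 1) u} := csInf_mem ⟨Ω, Or.inl le_rfl⟩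
  have hm := hm.resolve_left (not_le.2 hR)
  rw [Dv_iff] at hm
  push Not at hm
  obtain ⟨γ', hγ', hn⟩ := hm hu
  filter_upwards [hn] with n hn hg
  by_contra hc
  exact hn (Dv_anti (h2 _ hg) ((Order.lt_add_one_iff.1 hγ').trans (not_lt.1 hc)))

open Classical in
/-- The subword of colour `k`. -/
noncomputable def sub {N ι : Type} (w : List (N × ι)) (k : ι) : List N :=
  (w.filter (fun p => p.2 = k)).map Prod.fst

theorem sub_same {N ι : Type} (w : List (N × ι)) (n : N) (k : ι) :
    sub (w ++ [(n, k)]) k = sub w k ++ [n] := by simp [sub]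

theorem sub_ne {N ι : Type} (w : List (N × ι)) (n : N) (k j : ι) (h : k ≠ j) :
    sub (w ++ [(n, k)]) j = sub w j := by simp [sub, h]

theorem comb {N ι : Type} [Finite ι] (F : Filter N) (H : List N → Prop) (G : ι → List N → Prop)
    (hG : ∀ k l n, G k (l ++ [n]) → G k l)
    (hH : ∀ s, H s → ∃ w : List (N × ι), w.map Prod.fst = s ∧ ∀ k, G k (sub w k))
    (ξ : Ordinal.{w}) (h : Dv F H (omega0 ^ ξ) []) : ∃ k, Dv F (G k) (omega0 ^ ξ) [] := by
  obtain ⟨S, hS, hSb⟩ := exists_natSum.{w} ι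
  choose R hR1 hR2 hR3 using fun k => exists_rank F (G k) (omega0 ^ ξ)
  have hSle : ∀ f k, f k ≤ S f := by
    classical
    intro f k
    induction f using (wellFounded_lt (α := ι → Ordinal.{w})).induction with
    | _ f ih =>
    apply le_of_forall_lt
    intro c hc
    have hlt : Function.update f k c < f := by
      rw [update_lt_self_iff]; exact hc
    have h1 := ih _ hlt
    rw [Function.update_self] at h1
    exact h1.trans_lt (hS hlt)
  have main : ∀ γ : Ordinal.{w}, γ ≤ omega0 ^ ξ → ∀ s, Dv F H γ s →
      ∃ w : List (N × ι), w.map Prod.fst = s ∧ (∀ k, G k (sub w k)) ∧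
        γ ≤ S (fun k => R k (sub w k)) := by
    intro γ
    induction γ using WellFoundedLT.induction with
    | _ γ ih =>
    intro hγ s hs
    rw [Dv_iff] at hs
    by_contra hcon
    push Not at hcon
    let P : Set (List (N × ι)) := {w | w.map Prod.fst = s ∧ ∀ k, G k (sub w k)}
    have hPf : P.Finite := by
      refine ((List.finite_length_eq ι s.length).image (fun κ => s.zip κ)).subset ?_
      rintro w ⟨hw, -⟩
      refine ⟨w.map Prod.snd, ?_, ?_⟩
      · simp [← hw]
      · simp only [← hw]
        clear hw
        induction w with
        | nil => rfl
        | cons a l ih => simpa using ih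
    have hPne : P.Nonempty := hH s hs.1
    obtain ⟨w0, hw0, hmax⟩ := Set.exists_max_image P (fun w => S (fun k => R k (sub w k))) hPf hPne
    have hlt := hcon w0 hw0.1 hw0.2
    have hfr := hs.2 _ hlt
    have hev : ∀ᶠ n in F, ∀ w ∈ P, ∀ k, G k (sub w k ++ [n]) →
        R k (sub w k ++ [n]) < R k (sub w k) := by
      rw [Filter.eventually_all_finite hPf]
      intro w hw
      rw [Filter.eventually_all]
      intro k
      apply hR3 k _ (hw.2 k)
      by_contra hc
      exact absurd (hcon w hw.1 hw.2)
        (not_lt.2 (hγ.trans ((not_lt.1 hc).trans (hSle (fun k => R k (sub w k)) k))))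
    obtain ⟨n, hn, hn2⟩ := (hfr.and_eventually hev).exists
    obtain ⟨w', hw', hGw', hle⟩ := ih _ hlt (hlt.le.trans hγ) _ hn
    rcases List.eq_nil_or_concat' w' with rfl | ⟨w, ⟨n', k⟩, rfl⟩
    · simp at hw'
    simp only [List.map_append, List.map_cons, List.map_nil] at hw'
    obtain ⟨hw1, hw2⟩ := List.append_inj' hw' rfl
    simp only [List.cons.injEq, and_true] at hw2
    subst hw2
    have hGk : G k (sub w k ++ [n']) := by rw [← sub_same]; exact hGw' k
    have hwP : w ∈ P := by
      refine ⟨hw1, fun j => ?_⟩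
      by_cases hj : k = j
      · subst hj; exact hG _ _ _ hGk
      · rw [← sub_ne w n' k j hj]; exact hGw' j
    have hdec := hn2 w hwP k hGk
    have : S (fun j => R j (sub (w ++ [(n', k)]) j)) < S (fun j => R j (sub w j)) := by
      apply hS
      rw [Pi.lt_def]
      constructor
      · intro j
        by_cases hj : k = j
        · subst hj; simp only [sub_same]; exact hdec.le
        · simp only [sub_ne w n' k j hj]; exact le_rfl
      · exact ⟨k, by simp only [sub_same]; exact hdec⟩
    exact absurd (this.trans_le (hmax w hwP)) (not_lt.2 hle)
  obtain ⟨w, hw, hGw, hle⟩ := main _ le_rfl [] h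
  have hw : w = [] := by simpa using hw
  subst hw
  by_contra hcon
  push Not at hcon
  refine absurd (hSb ξ _ fun k => ?_) (not_lt.2 hle)
  refine lt_of_le_of_ne (hR1 k _) fun he => hcon k ?_
  have := hR2 k _ (hGw k)
  rw [he] at this
  exact this

end PaperAUS

namespace PaperAUS

universe w

theorem derivIter_zero {Λ : Type} (T : Set (List Λ)) : derivIter T (0 : Ordinal.{w}) = T := by
  simp [derivIter]

theorem derivIter_add_one {Λ : Type} (T : Set (List Λ)) (γ : Ordinal.{w}) :
    derivIter T (γ + 1) = derivIter T γ \ maxNodes (derivIter T γ) := by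
  simp [derivIter]

theorem derivIter_limit {Λ : Type} (T : Set (List Λ)) (γ : Ordinal.{w})
    (h : Order.IsSuccLimit γ) :
    derivIter T γ = ⋂ ζ : Set.Iio γ, derivIter T ζ.1 := by
  rw [derivIter, Ordinal.limitRecOn_limit _ _ _ _ h]
  rfl

theorem mem_derivIter {Λ : Type} (T : Set (List Λ)) (γ : Ordinal.{w}) :
    ∀ s, s ∈ derivIter T γ ↔ s ∈ T ∧ ∀ γ' < γ, ∃ t ∈ derivIter T γ', s <+: t ∧ t ≠ s := by
  induction γ using Ordinal.limitRecOn with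
  | zero => intro s; simp [derivIter_zero]
  | add_one γ ih =>
    intro s
    rw [derivIter_add_one]
    have : s ∈ derivIter T γ \ maxNodes (derivIter T γ) ↔
        s ∈ derivIter T γ ∧ ∃ t ∈ derivIter T γ, s <+: t ∧ t ≠ s := by
      constructor
      · rintro ⟨h1, h2⟩
        refine ⟨h1, ?_⟩
        by_contra hc
        push Not at hc
        exact h2 ⟨h1, hc⟩
      · rintro ⟨h1, t, ht, hp, hne⟩
        exact ⟨h1, fun h => hne (h.2 t ht hp)⟩
    rw [this, ih]
    constructor
    · rintro ⟨⟨h1, h2⟩, h3⟩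
      refine ⟨h1, fun γ' h' => ?_⟩
      rcases (Order.lt_add_one_iff.1 h').lt_or_eq with h | rfl
      · exact h2 _ h
      · exact h3
    · rintro ⟨h1, h2⟩
      exact ⟨⟨h1, fun γ' h' => h2 _ (h'.trans (lt_add_one γ))⟩, h2 _ (lt_add_one γ)⟩
  | limit γ hγ ih =>
    intro s
    rw [derivIter_limit T γ hγ, Set.mem_iInter]
    constructor
    · intro h
      refine ⟨?_, fun γ' h' => ?_⟩
      · have := h ⟨0, hγ.bot_lt⟩
        rwa [derivIter_zero] at this
      · have h1 := hγ.add_one_lt h'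
        exact ((ih _ h1 s).1 (h ⟨_, h1⟩)).2 γ' (lt_add_one γ')
    · rintro ⟨h1, h2⟩ ⟨ζ, hζ⟩
      exact (ih ζ hζ s).2 ⟨h1, fun γ' h' => h2 γ' (h'.trans hζ)⟩

theorem derivIter_anti {Λ : Type} {T : Set (List Λ)} {γ δ : Ordinal.{w}} {s : List Λ}
    (h : s ∈ derivIter T γ) (hd : δ ≤ γ) : s ∈ derivIter T δ := by
  rw [mem_derivIter] at *
  exact ⟨h.1, fun γ' h' => h.2 γ' (h'.trans_le hd)⟩

theorem derivIter_closed {Λ : Type} {T : Set (List Λ)} (hT : IsTree T) {γ : Ordinal.{w}}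
    {s t : List Λ} (ht : t ∈ derivIter T γ) (hp : s <+: t) (hs : s ≠ []) :
    s ∈ derivIter T γ := by
  by_cases he : t = s
  · rwa [← he]
  rw [mem_derivIter]
  refine ⟨hT.2 s t ((mem_derivIter T γ t).1 ht).1 hp hs, fun γ' h' => ?_⟩
  exact ⟨t, derivIter_anti ht h'.le, hp, he⟩

theorem rank_facts {Λ : Type} {T : Set (List Λ)} {Ω : Ordinal.{w}} (h : treeRank T = Ω)
    (h0 : Ω ≠ 0) : derivIter T Ω = ∅ ∧ ∀ γ < Ω, (derivIter T γ).Nonempty := by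
  have hne : {ξ : Ordinal.{w} | derivIter T ξ = ∅}.Nonempty := by
    by_contra hc
    rw [Set.not_nonempty_iff_eq_empty] at hc
    rw [treeRank, hc, Ordinal.sInf_empty] at h
    exact h0 h.symm
  constructor
  · have := csInf_mem hne
    rw [← treeRank, h] at this
    exact this
  · intro γ hγ
    rw [← h] at hγ
    have := notMem_of_lt_csInf hγ (OrderBot.bddBelow _)
    exact Set.nonempty_iff_ne_empty.2 this

theorem exists_rk {Λ : Type} {T : Set (List Λ)} {Ω : Ordinal.{w}} (h : treeRank T = Ω)
    (h0 : Ω ≠ 0) : ∃ rk : List Λ → Ordinal.{w}, (∀ s ∈ T, rk s < Ω) ∧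
      ∀ s t, t ∈ T → s <+: t → t ≠ s → rk t < rk s := by
  obtain ⟨hE, -⟩ := rank_facts h h0
  let rk : List Λ → Ordinal.{w} := fun s =>
    sInf {γ | ¬ ∃ t ∈ derivIter T γ, s <+: t ∧ t ≠ s}
  have hne : ∀ s, {γ | ¬ ∃ t ∈ derivIter T γ, s <+: t ∧ t ≠ s}.Nonempty := fun s =>
    ⟨Ω, by simp [hE]⟩
  have h1 : ∀ s, ¬ ∃ t ∈ derivIter T (rk s), s <+: t ∧ t ≠ s := fun s => csInf_mem (hne s)
  have h2 : ∀ s, ∀ γ < rk s, ∃ t ∈ derivIter T γ, s <+: t ∧ t ≠ s := fun s γ hγ => by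
    have := notMem_of_lt_csInf hγ (OrderBot.bddBelow _)
    exact not_not.1 this
  have h3 : ∀ s ∈ T, ∀ γ ≤ rk s, s ∈ derivIter T γ := fun s hs γ hγ => by
    rw [mem_derivIter]
    exact ⟨hs, fun γ' h' => h2 s γ' (h'.trans_le hγ)⟩
  refine ⟨rk, fun s hs => ?_, fun s t ht hp hne => ?_⟩
  · by_contra hc
    have := h3 s hs Ω (not_lt.1 hc)
    rw [hE] at this
    exact this
  · by_contra hc
    exact h1 s ⟨t, h3 t ht _ (not_lt.1 hc), hp, hne⟩

theorem netFilter_neBot {D : Type} {r : D → D → Prop} [Nonempty D] (h : IsDirSys r) :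
    (netFilter r).NeBot := by
  unfold netFilter
  apply Filter.iInf_neBot_of_directed
  · intro a b
    obtain ⟨c, hc1, hc2⟩ := h.2.2 a b
    refine ⟨c, ?_, ?_⟩
    · exact Filter.principal_mono.2 fun d hd => h.2.1 _ _ _ hc1 hd
    · exact Filter.principal_mono.2 fun d hd => h.2.1 _ _ _ hc2 hd
  · intro a
    exact Filter.principal_neBot_iff.2 ⟨a, h.1 a⟩

theorem exists_functional {Y : Type*} [NormedAddCommGroup Y] [NormedSpace ℝ Y] (s : Set Y)
    (hs : Convex ℝ s) (m : ℝ) (hm : ∀ v ∈ s, m ≤ ‖v‖) :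
    ∃ f : Y →L[ℝ] ℝ, ‖f‖ ≤ 1 ∧ ∀ v ∈ s, m ≤ f v := by
  rcases le_or_gt m 0 with h0 | h0
  · exact ⟨0, by simp, fun v _ => by simpa using h0⟩
  have hd : Disjoint (Metric.ball (0 : Y) m) s := by
    rw [Set.disjoint_left]
    intro v hv hvs
    rw [mem_ball_zero_iff] at hv
    exact absurd (hm v hvs) (not_le.2 hv)
  obtain ⟨f, u, hf1, hf2⟩ := geometric_hahn_banach_open (convex_ball 0 m) Metric.isOpen_ball hs hd
  have hu : 0 < u := by simpa using hf1 0 (by simpa using h0)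
  refine ⟨(m / u) • f, ?_, fun v hv => ?_⟩
  · apply ContinuousLinearMap.opNorm_le_of_unit_norm (𝕜 := ℝ) zero_le_one
    intro v hv
    have hfv : |f v| ≤ u / m := by
      have key : ∀ c : ℝ, 0 < c → c < m → |f v| * c ≤ u := by
        intro c hc hcm
        have e1 := hf1 (c • v) (by
          rw [mem_ball_zero_iff, norm_smul, hv, Real.norm_of_nonneg hc.le]; simpa using hcm)
        have e2 := hf1 (-(c • v)) (by
          rw [mem_ball_zero_iff, norm_neg, norm_smul, hv, Real.norm_of_nonneg hc.le]
          simpa using hcm)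
        rw [map_neg] at e2
        rw [map_smul, _root_.smul_eq_mul] at e1 e2
        rcases abs_cases (f v) with ⟨h, _⟩ | ⟨h, _⟩ <;> rw [h] <;> nlinarith
      rw [le_div_iff₀ h0]
      by_contra hc
      push Not at hc
      have hpos : 0 < |f v| := by
        by_contra hn
        have : |f v| = 0 := le_antisymm (not_lt.1 hn) (abs_nonneg _)
        rw [this] at hc; linarith
      obtain ⟨c, hc1, hc2⟩ := exists_between ((div_lt_iff₀' hpos).2 hc)
      have := key c ((div_pos hu hpos).trans hc1) hc2
      rw [div_lt_iff₀' hpos] at hc1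
      linarith
    rw [_root_.smul_apply, norm_smul, Real.norm_of_nonneg (div_pos h0 hu).le,
      Real.norm_eq_abs]
    calc m / u * |f v| ≤ m / u * (u / m) := by gcongr
      _ = 1 := by field_simp
  · rw [_root_.smul_apply, _root_.smul_eq_mul]
    calc m = m / u * u := by field_simp
      _ ≤ m / u * f v := by gcongr; exact hf2 v hv

theorem hull_norm_le {Λ D X : Type*} [NormedAddCommGroup X] [NormedSpace ℝ X]
    {T : Set (List Λ)} (hT : IsTree T) {x : List (Λ × D) → X} {σ : ℝ}
    (hx : ∀ t ∈ TD T D, ‖x t‖ ≤ σ) {t : List (Λ × D)} (ht : t ∈ TD T D) {v : X}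
    (hv : v ∈ convexHull ℝ (branchSet x t)) : ‖v‖ ≤ σ := by
  have : convexHull ℝ (branchSet x t) ⊆ Metric.closedBall 0 σ := by
    apply convexHull_min _ (convex_closedBall 0 σ)
    rintro _ ⟨s, hs, hp, rfl⟩
    rw [mem_closedBall_zero_iff]
    exact hx s (hT.2 _ _ ht (hp.map _) (by simpa using hs))
  simpa using this hv

theorem realize {X Y : Type*} [NormedAddCommGroup X] [NormedSpace ℝ X]
    [NormedAddCommGroup Y] [NormedSpace ℝ Y] (ξ : Ordinal.{w}) (A : X →L[ℝ] Y) (σ : ℝ)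
    {Λ N : Type} [Inhabited N] (T : Set (List Λ)) (hT : IsTree T)
    (hrank : treeRank T = omega0 ^ ξ) (F : Filter N) (z : N → X) (hz : ∀ n, ‖z n‖ ≤ σ)
    (hzF : ∀ f : X →L[ℝ] ℝ, Tendsto (fun n => f (z n)) F (nhds 0)) (y : Y) (hy : ‖y‖ ≤ 1)
    (a : ℝ) (G : List N → Prop)
    (hG : ∀ l, G l → ∀ v ∈ convexHull ℝ (z '' {n | n ∈ l}), a ≤ ‖y + A v‖)
    (hD : Dv F G (omega0 ^ ξ) []) : a - 1 ≤ rho ξ A σ := by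
  classical
  have h0 : (omega0 : Ordinal.{w}) ^ ξ ≠ 0 := (opow_pos ξ omega0_pos).ne'
  obtain ⟨rk, hrk1, hrk2⟩ := exists_rk hrank h0
  let D : Type := {V : Set N // V ∈ F}
  let r : D → D → Prop := fun V W => W.1 ⊆ V.1
  have hDir : IsDirSys r := ⟨fun _ => subset_rfl, fun _ _ _ h1 h2 => h2.trans h1,
    fun V W => ⟨⟨V.1 ∩ W.1, Filter.inter_mem V.2 W.2⟩, Set.inter_subset_left,
      Set.inter_subset_right⟩⟩
  let pick : List Λ → List N → Λ × D → N := fun hist l p =>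
    if h : ∃ n ∈ p.2.1, Dv F G (rk (hist ++ [p.1])) (l ++ [n]) then h.choose else default
  have hpick : ∀ hist l p, (∃ n ∈ p.2.1, Dv F G (rk (hist ++ [p.1])) (l ++ [n])) →
      pick hist l p ∈ p.2.1 ∧ Dv F G (rk (hist ++ [p.1])) (l ++ [pick hist l p]) := by
    intro hist l p h
    simp only [pick, dif_pos h]
    exact h.choose_spec
  let φ : List (Λ × D) → List N := fun t =>
    List.reverseRecOn (motive := fun _ => List N) t [] (fun t p l => l ++ [pick (t.map Prod.fst) l p])
  have hφ0 : φ [] = [] := by simp [φ]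
  have hφ1 : ∀ t p, φ (t ++ [p]) = φ t ++ [pick (t.map Prod.fst) (φ t) p] := by
    intro t p; simp [φ]
  let x : List (Λ × D) → X := fun t => z ((φ t).getLast?.getD default)
  have hx1 : ∀ t p, x (t ++ [p]) = z (pick (t.map Prod.fst) (φ t) p) := by
    intro t p; simp only [x, hφ1]; simp
  have hstep : ∀ t : List (Λ × D), ∀ p, t ++ [p] ∈ TD T D →
      (∀ γ < omega0 ^ ξ, t = [] → ∃ᶠ n in F, Dv F G γ (φ t ++ [n])) →
      (t ≠ [] → Dv F G (rk (t.map Prod.fst)) (φ t)) →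
      pick (t.map Prod.fst) (φ t) p ∈ p.2.1 ∧
        Dv F G (rk ((t ++ [p]).map Prod.fst)) (φ (t ++ [p])) := by
    intro t p htp hnil hcons
    have hmem : t.map Prod.fst ++ [p.1] ∈ T := by simpa [TD] using htp
    have hf : ∃ᶠ n in F, Dv F G (rk (t.map Prod.fst ++ [p.1])) (φ t ++ [n]) := by
      by_cases ht : t = []
      · exact hnil _ (hrk1 _ hmem) ht
      · exact ((Dv_iff _ _ _ _).1 (hcons ht)).2 _
          (hrk2 _ _ hmem (List.prefix_append _ _) (by simp))
    have hex : ∃ n ∈ p.2.1, Dv F G (rk (t.map Prod.fst ++ [p.1])) (φ t ++ [n]) := by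
      obtain ⟨n, hn1, hn2⟩ := (hf.and_eventually p.2.2).exists
      exact ⟨n, hn2, hn1⟩
    have := hpick _ _ p hex
    rw [hφ1]
    simpa using this
  have hbase : ∀ t : List (Λ × D), ∀ γ < omega0 ^ ξ, t = [] → ∃ᶠ n in F, Dv F G γ (φ t ++ [n]) := by
    rintro t γ hγ rfl
    rw [hφ0]
    exact ((Dv_iff _ _ _ _).1 hD).2 γ hγ
  have hinv : ∀ t : List (Λ × D), t ∈ TD T D → Dv F G (rk (t.map Prod.fst)) (φ t) := by
    intro t
    induction t using List.reverseRecOn with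
    | nil => intro h; exact absurd h hT.1
    | append_singleton t p ih =>
      intro h
      refine (hstep t p h (hbase t) fun ht => ih ?_).2
      exact hT.2 _ _ h (by simp) (by simpa using ht)
  have hpk : ∀ (t : List (Λ × D)) p, t ++ [p] ∈ TD T D → pick (t.map Prod.fst) (φ t) p ∈ p.2.1 := by
    intro t p h
    refine (hstep t p h (hbase t) fun ht => hinv t ?_).1
    exact hT.2 _ _ h (by simp) (by simpa using ht)
  have hbr : ∀ t : List (Λ × D), branchSet x t ⊆ z '' {n | n ∈ φ t} := by
    intro t
    induction t using List.reverseRecOn with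
    | nil =>
      rintro _ ⟨s, hs, hp, rfl⟩
      exact absurd (List.prefix_nil.1 hp) hs
    | append_singleton t p ih =>
      rintro _ ⟨s, hs, hp, rfl⟩
      rw [hφ1]
      rcases List.prefix_concat_iff.1 hp with rfl | hp
      · rw [hx1]
        exact ⟨_, by simp, rfl⟩
      · obtain ⟨n, hn, he⟩ := ih ⟨s, hs, hp, rfl⟩
        exact ⟨n, by simp only [Set.mem_ofPred_eq] at *; simp [hn], he⟩
  have hxn : ∀ t, ‖x t‖ ≤ σ := fun t => hz _
  have hTne : ∃ t, t ∈ TD T D := by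
    obtain ⟨s, hs⟩ := (rank_facts hrank h0).2 0 (opow_pos ξ omega0_pos)
    rw [derivIter_zero] at hs
    refine ⟨s.map (fun l => (l, ⟨Set.univ, Filter.univ_mem⟩)), ?_⟩
    simpa [TD, Function.comp_def] using hs
  have hwn : WeaklyNullColl T r x := by
    intro t ζ htu f
    have : Tendsto (fun u : D => pick (t.map Prod.fst) (φ t) (ζ, u)) (netFilter r) F := by
      intro V hV
      rw [Filter.mem_map]
      refine Filter.mem_iInf_of_mem (⟨V, hV⟩ : D) ?_
      rw [Filter.mem_principal]
      intro W hW
      exact hW (hpk t (ζ, W) (htu W))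
    simp only [hx1]
    exact (hzF f).comp this
  have hle : a - 1 ≤ sInf {c : ℝ | ∃ t ∈ TD T D, ∃ v ∈ convexHull ℝ (branchSet x t),
      c = ‖y + A v‖ - 1} := by
    apply le_csInf
    · obtain ⟨t, ht⟩ := hTne
      have : t ≠ [] := by rintro rfl; exact hT.1 ht
      exact ⟨_, t, ht, x t, subset_convexHull _ _ ⟨t, this, List.prefix_rfl, rfl⟩, rfl⟩
    · rintro _ ⟨t, ht, v, hv, rfl⟩
      have := hG _ ((Dv_iff _ _ _ _).1 (hinv t ht)).1 v (convexHull_mono (hbr t) hv)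
      linarith
  refine hle.trans (le_csSup ?_ ?_)
  · refine ⟨‖A‖ * σ, ?_⟩
    rintro _ ⟨Λ', D', r', T', y', x', ⟨u⟩, -, hT', hrank', hy', hx', -, rfl⟩
    obtain ⟨s, hs⟩ := (rank_facts hrank' h0).2 0 (opow_pos ξ omega0_pos)
    rw [derivIter_zero] at hs
    have ht : s.map (fun l => (l, u)) ∈ TD T' D' := by
      simpa [TD, Function.comp_def] using hs
    set t := s.map (fun l => (l, u))
    have htn : t ≠ [] := by
      intro h
      rw [h] at ht; exact hT'.1 ht
    have hv : x' t ∈ convexHull ℝ (branchSet x' t) :=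
      subset_convexHull _ _ ⟨t, htn, List.prefix_rfl, rfl⟩
    refine le_trans (b := ‖y' + A (x' t)‖ - 1) (csInf_le ⟨-1, ?_⟩ ⟨t, ht, x' t, hv, rfl⟩) ?_
    · rintro _ ⟨_, _, v, _, rfl⟩
      linarith [norm_nonneg (y' + A v)]
    · have h1 := norm_add_le y' (A (x' t))
      have h2 := A.le_opNorm (x' t)
      have h3 : ‖A‖ * ‖x' t‖ ≤ ‖A‖ * σ := by gcongr; exact hx' t ht
      linarith
  · exact ⟨Λ, D, r, T, y, x, ⟨(⟨Set.univ, Filter.univ_mem⟩ : D)⟩, hDir, hT, hrank, hy,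
      fun t _ => hxn t, hwn, rfl⟩

end PaperAUS

namespace PaperAUS

universe w

theorem hull_bound {X Y : Type*} [NormedAddCommGroup X] [NormedSpace ℝ X]
    [NormedAddCommGroup Y] [NormedSpace ℝ Y] (A : X →L[ℝ] Y) (y : Y) (a : ℝ) (S : Set X)
    (f : Y →L[ℝ] ℝ) (hf : ‖f‖ ≤ 1) (h : ∀ v ∈ S, a ≤ f (y + A v)) :
    ∀ v ∈ convexHull ℝ S, a ≤ ‖y + A v‖ := by
  intro v hv
  have hc : Convex ℝ {v : X | a - f y ≤ (f.comp A) v} :=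
    convex_halfSpace_ge (f.comp A).isLinear _
  have hsub : convexHull ℝ S ⊆ {v : X | a - f y ≤ (f.comp A) v} := by
    apply convexHull_min _ hc
    intro v hv
    have := h v hv
    rw [map_add] at this
    simp only [Set.mem_ofPred_eq, ContinuousLinearMap.comp_apply]
    linarith
  have h1 := hsub hv
  simp only [Set.mem_ofPred_eq, ContinuousLinearMap.comp_apply] at h1
  have h2 : f (y + A v) ≤ ‖y + A v‖ := by
    calc f (y + A v) ≤ ‖f (y + A v)‖ := le_abs_self _
      _ ≤ ‖f‖ * ‖y + A v‖ := f.le_opNorm _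
      _ ≤ 1 * ‖y + A v‖ := by gcongr
      _ = _ := one_mul _
  rw [map_add] at h2
  linarith

/-- The list of nonempty initial segments of a node. -/
def br {M : Type} (t : List M) : List (List M) := t.inits.filter (fun s => !s.isEmpty)

theorem br_nil {M : Type} : br ([] : List M) = [] := by simp [br]

theorem br_concat {M : Type} (t : List M) (p : M) : br (t ++ [p]) = br t ++ [t ++ [p]] := by
  simp [br, List.inits_append]

theorem mem_br {M : Type} (t s : List M) : s ∈ br t ↔ s <+: t ∧ s ≠ [] := by
  simp [br]

theorem main_le {X Y : Type*} [NormedAddCommGroup X] [NormedSpace ℝ X]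
    [NormedAddCommGroup Y] [NormedSpace ℝ Y] (ξ : Ordinal.{w}) (A B : X →L[ℝ] Y)
    (α β : ℝ) (hα : 0 < α) (hβ : 0 < β) (hαβ : α + β = 1) (σ : ℝ) (hσ : 0 < σ)
    (Λ D : Type) (r : D → D → Prop) (T : Set (List Λ)) (y : Y) (x : List (Λ × D) → X)
    (hDne : Nonempty D) (hr : IsDirSys r) (hT : IsTree T) (hrank : treeRank T = omega0 ^ ξ)
    (hy : ‖y‖ ≤ 1) (hx : ∀ t ∈ TD T D, ‖x t‖ ≤ σ) (hwn : WeaklyNullColl T r x) :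
    sInf {c : ℝ | ∃ t ∈ TD T D, ∃ v ∈ convexHull ℝ (branchSet x t),
      c = ‖y + (α • A + β • B) v‖ - 1} ≤ α * rho ξ A σ + β * rho ξ B σ := by
  classical
  have h0 : (omega0 : Ordinal.{w}) ^ ξ ≠ 0 := (opow_pos ξ omega0_pos).ne'
  set C := α • A + β • B with hC
  have hCv : ∀ v, C v = α • A v + β • B v := fun v => by simp [hC]
  set ρ := sInf {c : ℝ | ∃ t ∈ TD T D, ∃ v ∈ convexHull ℝ (branchSet x t),
      c = ‖y + C v‖ - 1} with hρ
  have hρle : ∀ t ∈ TD T D, ∀ v ∈ convexHull ℝ (branchSet x t), 1 + ρ ≤ ‖y + C v‖ := by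
    intro t ht v hv
    have : ρ ≤ ‖y + C v‖ - 1 := by
      refine csInf_le ⟨-1, ?_⟩ ⟨t, ht, v, hv, rfl⟩
      rintro _ ⟨_, _, v, _, rfl⟩
      linarith [norm_nonneg (y + C v)]
    linarith
  let N : Type := List (Λ × D)
  let z : N → X := fun n => if n ∈ TD T D then x n else 0
  have hz : ∀ n, ‖z n‖ ≤ σ := by
    intro n
    by_cases h : n ∈ TD T D
    · simp only [z, if_pos h]; exact hx n h
    · simp only [z, if_neg h]; simpa using hσ.le
  have hzx : ∀ n ∈ TD T D, z n = x n := fun n h => by simp only [z, if_pos h]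
  let F : Filter N := ⨅ f : X →L[ℝ] ℝ, Filter.comap (fun n => f (z n)) (nhds 0)
  have hzF : ∀ f : X →L[ℝ] ℝ, Tendsto (fun n => f (z n)) F (nhds 0) := fun f =>
    Filter.tendsto_comap.mono_left (iInf_le _ f)
  let H : List N → Prop := fun l => ∃ f : Y →L[ℝ] ℝ, ‖f‖ ≤ 1 ∧ ∀ n ∈ l, 1 + ρ ≤ f (y + C (z n))
  have hHbr : ∀ t ∈ TD T D, H (br t) := by
    intro t ht
    obtain ⟨f, hf1, hf2⟩ := exists_functional ((fun v => y + C v) '' convexHull ℝ (branchSet x t))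
      (by
        have h1 : Convex ℝ (C '' convexHull ℝ (branchSet x t)) :=
          (convex_convexHull ℝ _).is_linear_image C.isLinear
        have := h1.translate y
        rwa [Set.image_image] at this) (1 + ρ)
      (by
        rintro _ ⟨v, hv, rfl⟩
        exact hρle t ht v hv)
    refine ⟨f, hf1, fun n hn => hf2 _ ⟨z n, ?_, rfl⟩⟩
    obtain ⟨hp, hne⟩ := (mem_br _ _).1 hn
    rw [hzx n (hT.2 _ _ ht (hp.map _) (by simpa using hne))]
    exact subset_convexHull _ _ ⟨n, hne, hp, rfl⟩
  have hnb := netFilter_neBot hr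
  have hfreq : ∀ (t : List (Λ × D)) (ζ : Λ) (Q : N → Prop), t.map Prod.fst ++ [ζ] ∈ T →
      (∀ u, Q (t ++ [(ζ, u)])) → ∃ᶠ n in F, Q n := by
    intro t ζ Q ht hQ
    have hmem : ∀ u : D, t ++ [(ζ, u)] ∈ TD T D := fun u => by simpa [TD] using ht
    have htend : Tendsto (fun u : D => (t ++ [(ζ, u)] : N)) (netFilter r) F := by
      rw [Filter.tendsto_iInf]
      intro f
      rw [Filter.tendsto_comap_iff]
      refine (hwn t ζ hmem f).congr fun u => ?_
      simp only [Function.comp_apply, hzx _ (hmem u)]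
    exact htend.frequently (Filter.Eventually.frequently (Filter.Eventually.of_forall hQ))
  have hDt : ∀ γ : Ordinal.{w}, ∀ t : List (Λ × D), t.map Prod.fst ∈ derivIter T γ →
      Dv F H γ (br t) := by
    intro γ
    induction γ using WellFoundedLT.induction with
    | _ γ ih =>
    intro t ht
    have ht' := (mem_derivIter T γ _).1 ht
    rw [Dv_iff]
    refine ⟨hHbr t ht'.1, fun γ' h' => ?_⟩
    obtain ⟨s, hs, ⟨q, rfl⟩, hne⟩ := ht'.2 γ' h'
    cases q with
    | nil => simp at hne
    | cons ζ q =>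
      have h1 : t.map Prod.fst ++ [ζ] ∈ derivIter T γ' :=
        derivIter_closed hT hs ⟨q, by simp⟩ (by simp)
      refine hfreq t ζ (fun n => Dv F H γ' (br t ++ [n])) ((mem_derivIter T γ' _).1 h1).1 fun u => ?_
      rw [← br_concat]
      exact ih γ' h' _ (by simpa using h1)
  have hDnil : Dv F H (omega0 ^ ξ) [] := by
    rw [Dv_iff]
    refine ⟨⟨0, by simp, by simp⟩, fun γ' h' => ?_⟩
    obtain ⟨s, hs⟩ := (rank_facts hrank h0).2 γ' h'
    cases s with
    | nil => exact absurd ((mem_derivIter T γ' _).1 hs).1 hT.1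
    | cons ζ q =>
      have h1 : [ζ] ∈ derivIter T γ' := derivIter_closed hT hs ⟨q, by simp⟩ (by simp)
      refine hfreq [] ζ (fun n => Dv F H γ' ([] ++ [n])) ((mem_derivIter T γ' _).1 h1).1 fun u => ?_
      have := hDt γ' [(ζ, u)] (by simpa using h1)
      have h2 : br [(ζ, u)] = [[(ζ, u)]] := by simp [br]
      rw [h2] at this
      exact this
  apply le_of_forall_pos_le_add
  intro ε hε
  set P := 1 + ‖A‖ * σ with hP
  let ι : Type := ↥(Finset.Icc ⌊-P / ε⌋ ⌊P / ε⌋)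
  let G : ι → List N → Prop := fun k l => ∃ f : Y →L[ℝ] ℝ, ‖f‖ ≤ 1 ∧ ∀ n ∈ l,
    (k.1 : ℝ) * ε ≤ f (y + A (z n)) ∧ (1 + ρ - α * ((k.1 + 1 : ℝ) * ε)) / β ≤ f (y + B (z n))
  have hG : ∀ k l n, G k (l ++ [n]) → G k l := by
    rintro k l n ⟨f, hf1, hf2⟩
    exact ⟨f, hf1, fun m hm => hf2 m (by simp [hm])⟩
  have hH : ∀ s, H s → ∃ w : List (N × ι), w.map Prod.fst = s ∧ ∀ k, G k (sub w k) := by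
    rintro s ⟨f, hf1, hf2⟩
    have hb : ∀ n, |f (y + A (z n))| ≤ P := by
      intro n
      calc |f (y + A (z n))| ≤ ‖f‖ * ‖y + A (z n)‖ := f.le_opNorm _
        _ ≤ 1 * ‖y + A (z n)‖ := by gcongr
        _ = ‖y + A (z n)‖ := one_mul _
        _ ≤ ‖y‖ + ‖A (z n)‖ := norm_add_le _ _
        _ ≤ 1 + ‖A‖ * ‖z n‖ := add_le_add hy (A.le_opNorm _)
        _ ≤ P := by rw [hP]; gcongr; exact hz n
    let col : N → ι := fun n => ⟨⌊f (y + A (z n)) / ε⌋, by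
      rw [Finset.mem_Icc]
      have := abs_le.1 (hb n)
      constructor
      · apply Int.floor_mono; gcongr; exact this.1
      · apply Int.floor_mono; gcongr; exact this.2⟩
    refine ⟨s.map fun n => (n, col n), by simp [Function.comp_def], fun k => ⟨f, hf1, ?_⟩⟩
    intro n hn
    have hn' : n ∈ s ∧ col n = k := by
      simp only [sub, List.mem_map, List.mem_filter] at hn
      obtain ⟨⟨n1, k1⟩, ⟨⟨n2, h2, he⟩, hk⟩, rfl⟩ := hn
      simp only [Prod.mk.injEq] at he
      obtain ⟨rfl, rfl⟩ := he
      exact ⟨h2, by simpa using hk⟩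
    obtain ⟨hns, rfl⟩ := hn'
    have e1 : ((col n).1 : ℝ) ≤ f (y + A (z n)) / ε := Int.floor_le _
    have e2 : f (y + A (z n)) / ε < (col n).1 + 1 := Int.lt_floor_add_one _
    rw [le_div_iff₀ hε] at e1
    rw [div_lt_iff₀ hε] at e2
    refine ⟨e1, ?_⟩
    have e3 := hf2 n hns
    have e4 : f (y + C (z n)) = α * f (y + A (z n)) + β * f (y + B (z n)) := by
      have hyy : f y = α * f y + β * f y := by rw [← add_mul, hαβ, one_mul]
      rw [hCv, map_add, map_add, map_add, map_add, map_smul, map_smul, _root_.smul_eq_mul,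
        _root_.smul_eq_mul]
      linarith
    rw [div_le_iff₀ hβ]
    have e5 := mul_lt_mul_of_pos_left e2 hα
    linarith
  obtain ⟨k, hk⟩ := comb F H G hG hH ξ hDnil
  have : Inhabited N := ⟨[]⟩
  have hA := realize ξ A σ T hT hrank F z hz hzF y hy ((k.1 : ℝ) * ε) (G k) (by
    rintro l ⟨f, hf1, hf2⟩
    apply hull_bound A y _ _ f hf1
    rintro _ ⟨n, hn, rfl⟩
    exact (hf2 n hn).1) hk
  have hB := realize ξ B σ T hT hrank F z hz hzF y hy
    ((1 + ρ - α * ((k.1 + 1 : ℝ) * ε)) / β) (G k) (by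
    rintro l ⟨f, hf1, hf2⟩
    apply hull_bound B y _ _ f hf1
    rintro _ ⟨n, hn, rfl⟩
    exact (hf2 n hn).2) hk
  have hA' := mul_le_mul_of_nonneg_left hA hα.le
  have hB' := mul_le_mul_of_nonneg_left hB hβ.le
  rw [_root_.mul_sub, mul_div_cancel₀ _ hβ.ne'] at hB'
  have hαε : α * ε ≤ ε := by nlinarith
  nlinarith

end PaperAUS

namespace PaperAUS

/-- convexity of the modulus `ϱ_ξ(σ, ·)` in the operator. -/
theorem rho_convex {X Y : Type*} [NormedAddCommGroup X] [NormedSpace ℝ X]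
    [NormedAddCommGroup Y] [NormedSpace ℝ Y] (ξ : Ordinal) (A B : X →L[ℝ] Y)
    (α β : ℝ) (hα : 0 < α) (hβ : 0 < β) (hαβ : α + β = 1) :
    ∀ σ : ℝ, 0 < σ → rho ξ (α • A + β • B) σ ≤ α * rho ξ A σ + β * rho ξ B σ := by
  intro σ hσ
  by_cases hex : ∃ (Λ D : Type) (r : D → D → Prop) (T : Set (List Λ))
    (y : Y) (x : List (Λ × D) → X),
    Nonempty D ∧ IsDirSys r ∧ IsTree T ∧ treeRank T = omega0 ^ ξ ∧
    ‖y‖ ≤ 1 ∧ (∀ t ∈ TD T D, ‖x t‖ ≤ σ) ∧ WeaklyNullColl T r x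
  · rw [rho]
    apply csSup_le
    · obtain ⟨Λ, D, r, T, y, x, h1, h2, h3, h4, h5, h6, h7⟩ := hex
      exact ⟨_, Λ, D, r, T, y, x, h1, h2, h3, h4, h5, h6, h7, rfl⟩
    · rintro _ ⟨Λ, D, r, T, y, x, h1, h2, h3, h4, h5, h6, h7, rfl⟩
      exact main_le ξ A B α β hα hβ hαβ σ hσ Λ D r T y x h1 h2 h3 h4 h5 h6 h7
  · have hz : ∀ C : X →L[ℝ] Y, rho ξ C σ = 0 := by
      intro C
      rw [rho]
      convert Real.sSup_empty
      rw [Set.eq_empty_iff_forall_notMem]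
      rintro _ ⟨Λ, D, r, T, y, x, h1, h2, h3, h4, h5, h6, h7, rfl⟩
      exact hex ⟨Λ, D, r, T, y, x, h1, h2, h3, h4, h5, h6, h7⟩
    rw [hz, hz, hz]
    simp

end PaperAUS
end
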